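/- Let O be a set of labels and let A_comp^O be the set of annotation DAGs reachable from A_init = ({⊥}, ∅, ∅) by a finite (possibly empty) sequence of forward annotation transitions with labels in O. Then A_comp^O is closed under combined transitions with labels in O in both directions: if A ∈ A_comp^O and either A ⇀(p,Rd,Wt) A' or A' ⇀(p,Rd,Wt) A for some (p,Rd,Wt) ∈ O, then A' ∈ A_comp^O. -/

import Mathlib

namespace CRIL

/-- Process identifiers: finite lists of positive integers. -/
abbrev PID := List ℕ+

/-- Nodes of an annotation DAG: either ⊥ or a pair (p, n). -/
inductive ANode where
  | bot : ANode
  | node : PID → ℕ → ANode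
deriving DecidableEq

/-- Labeled edges. -/
abbrev AEdge (R : Type) := ANode × R × ANode

/-- Annotation DAGs, with the five defining conditions. -/
structure AnnDAG (R : Type) where
  V : Set ANode
  ER : Set (AEdge R)
  EW : Set (AEdge R)
  finV : V.Finite
  bot_mem : ANode.bot ∈ V
  down : ∀ p n, ANode.node p n ∈ V → ∀ n' ≤ n, ANode.node p n' ∈ V
  edges_sub : ∀ e ∈ ER ∪ EW, e.1 ∈ V ∧ e.2.2 ∈ V
  in_unique : ∀ v' v'' r v, (v', r, v) ∈ ER ∪ EW → (v'', r, v) ∈ ER ∪ EW → v' = v''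
  disj : ER ∩ EW = ∅
  acyclic : ∀ v, ¬ Relation.TransGen (fun a b => ∃ r, (a, r, b) ∈ ER ∪ EW) v v
  w_pred : ∀ v' r v, (v', r, v) ∈ EW → v' ≠ ANode.bot → ∃ v'', (v'', r, v') ∈ EW
  w_out_unique : ∀ v r v' v'', (v, r, v') ∈ EW → (v, r, v'') ∈ EW → v' = v''

-- `last(r, E_W)`: the final node of the unique maximal chain of `r`-labeled
-- `E_W`-edges starting at ⊥ (⊥ if there is no such edge).
open Classical in
noncomputable def lastN {R : Type} (EW : Set (AEdge R)) (r : R) : ANode :=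
  if h : ∃! v, Relation.ReflTransGen (fun a b => (a, r, b) ∈ EW) ANode.bot v ∧
      ∀ w, (v, r, w) ∉ EW
  then h.exists.choose
  else ANode.bot

/-- `max_p(V) + 1`: one plus the largest `n` with `(p,n) ∈ V` (0 if none). -/
noncomputable def maxpSucc (V : Set ANode) (p : PID) : ℕ :=
  sSup {m : ℕ | ∃ n, m = n + 1 ∧ ANode.node p n ∈ V}

/-- `max_p(V)` as an integer, −1 if no `(p,n) ∈ V`. -/
noncomputable def maxp (V : Set ANode) (p : PID) : ℤ :=
  (maxpSucc V p : ℤ) - 1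

/-- Labels (p, Rd, Wt). -/
abbrev Label (R : Type) := PID × Set R × Set R

/-- Forward annotation transition A₁ ⇀(p,Rd,Wt) A₂. -/
def Step {R : Type} (A₁ A₂ : AnnDAG R) (p : PID) (Rd Wt : Set R) : Prop :=
  A₂.V = A₁.V ∪ {ANode.node p (maxpSucc A₁.V p)} ∧
  A₂.ER = A₁.ER ∪
    {e | ∃ r ∈ Rd \ Wt, e = (lastN A₁.EW r, r, ANode.node p (maxpSucc A₁.V p))} ∧
  A₂.EW = A₁.EW ∪
    {e | ∃ r ∈ Wt, e = (lastN A₁.EW r, r, ANode.node p (maxpSucc A₁.V p))}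

/-- Forward transition with some label. -/
def StepAny {R : Type} (A₁ A₂ : AnnDAG R) : Prop := ∃ p Rd Wt, Step A₁ A₂ p Rd Wt

/-- Forward transition with some label in `O`. -/
def StepIn {R : Type} (O : Set (Label R)) (A₁ A₂ : AnnDAG R) : Prop :=
  ∃ l ∈ O, Step A₁ A₂ l.1 l.2.1 l.2.2

/-- The initial annotation DAG ({⊥}, ∅, ∅). -/
def Ainit (R : Type) : AnnDAG R where
  V := {ANode.bot}
  ER := ∅
  EW := ∅
  finV := Set.finite_singleton _
  bot_mem := rfl
  down := by intro p n h; simp at h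
  edges_sub := by intro e he; simp at he
  in_unique := by intro v' v'' r v h; simp at h
  disj := by simp
  acyclic := by
    intro v h
    have hne : ∀ a b : ANode, ¬ ∃ r : R, (a, r, b) ∈ (∅ ∪ ∅ : Set (AEdge R)) := by simp
    cases h with
    | single h' => exact hne _ _ h'
    | tail _ h' => exact hne _ _ h'
  w_pred := by intro v' r v h; simp at h
  w_out_unique := by intro v r v' v'' h; simp at h

/-- Signed labels: forward or underlined (backward). -/
inductive SLabel (R : Type) where
  | fwd : Label R → SLabel R
  | bwd : Label R → SLabel R

/-- `und`: forget the underline. -/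
def und {R : Type} : SLabel R → Label R
  | .fwd a => a
  | .bwd a => a

/-- The underline-toggle. -/
def toggle {R : Type} : SLabel R → SLabel R
  | .fwd a => .bwd a
  | .bwd a => .fwd a

/-- Combined transitions: forward, or reversed forward. -/
def CStep {R : Type} (A A' : AnnDAG R) : SLabel R → Prop
  | .fwd a => Step A A' a.1 a.2.1 a.2.2
  | .bwd a => Step A' A a.1 a.2.1 a.2.2

/-- Independence of signed labels: incomparable pids and disjoint read/write sets. -/
def indepLab {R : Type} (α β : SLabel R) : Prop :=
  ¬ (und α).1 <+: (und β).1 ∧ ¬ (und β).1 <+: (und α).1 ∧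
  (und α).2.1 ∩ (und β).2.2 = ∅ ∧ (und β).2.1 ∩ (und α).2.2 = ∅

/-- `diff` of a combined transition. -/
def diff {R : Type} (A A' : AnnDAG R) (α : SLabel R) :
    Set ANode × Set (AEdge R) × Set (AEdge R) :=
  match α with
  | .fwd _ => (A'.V \ A.V, A'.ER \ A.ER, A'.EW \ A.EW)
  | .bwd _ => (A.V \ A'.V, A.ER \ A'.ER, A.EW \ A'.EW)

/-- The underlying triple of an annotation DAG. -/
def triple {R : Type} (A : AnnDAG R) : Set ANode × Set (AEdge R) × Set (AEdge R) :=
  (A.V, A.ER, A.EW)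

/-- The ⊙^α operation on triples. -/
def odot {R : Type} (α : SLabel R)
    (T Δ : Set ANode × Set (AEdge R) × Set (AEdge R)) :
    Set ANode × Set (AEdge R) × Set (AEdge R) :=
  match α with
  | .fwd _ => (T.1 ∪ Δ.1, T.2.1 ∪ Δ.2.1, T.2.2 ∪ Δ.2.2)
  | .bwd _ => (T.1 \ Δ.1, T.2.1 \ Δ.2.1, T.2.2 \ Δ.2.2)

theorem AnnDAG.ext_of_components {R : Type} {A B : AnnDAG R} (hV : A.V = B.V)
    (hR : A.ER = B.ER) (hW : A.EW = B.EW) : A = B := by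
  cases A; cases B; cases hV; cases hR; cases hW; rfl

theorem AnnDAG.node_mem_iff {R : Type} (A : AnnDAG R) (p : PID) (n : ℕ) :
    ANode.node p n ∈ A.V ↔ n < maxpSucc A.V p := by
  set S : Set ℕ := {m : ℕ | ∃ n, m = n + 1 ∧ ANode.node p n ∈ A.V} with hS
  have hfin : S.Finite := by
    refine (A.finV.image (fun v => match v with
      | ANode.bot => 0
      | ANode.node _ k => k + 1)).subset ?_
    rintro m ⟨k, rfl, hk⟩
    exact ⟨_, hk, rfl⟩
  constructor
  · intro h
    exact Nat.lt_of_succ_le (le_csSup hfin.bddAbove ⟨n, rfl, h⟩)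
  · intro h
    change n < sSup S at h
    have hne : S.Nonempty := by
      by_contra hempty
      rw [Set.not_nonempty_iff_eq_empty.mp hempty] at h
      simp at h
    obtain ⟨k, hk, hmem⟩ := Nat.sSup_mem hne hfin.bddAbove
    exact A.down p k hmem n (by omega)

theorem lastN_congr {R : Type} {E E' : Set (AEdge R)} {r : R}
    (h : ∀ x y, (x, r, y) ∈ E ↔ (x, r, y) ∈ E') : lastN E r = lastN E' r := by
  have hpred : (fun v => Relation.ReflTransGen (fun a b => (a, r, b) ∈ E) ANode.bot v ∧
      ∀ w, (v, r, w) ∉ E) = fun v => Relation.ReflTransGen (fun a b => (a, r, b) ∈ E')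
      ANode.bot v ∧ ∀ w, (v, r, w) ∉ E' := by
    simp only [h]
  unfold lastN
  congr!

theorem reflTransGen_lastN {R : Type} (E : Set (AEdge R)) (r : R) :
    Relation.ReflTransGen (fun a b => (a, r, b) ∈ E) ANode.bot (lastN E r) := by
  unfold lastN
  split_ifs with h
  · exact h.exists.choose_spec.1
  · exact .refl

theorem AnnDAG.lastN_mem {R : Type} (A : AnnDAG R) (r : R) : lastN A.EW r ∈ A.V := by
  rcases Relation.ReflTransGen.cases_tail (reflTransGen_lastN A.EW r) with h | ⟨u, -, hu⟩
  · rw [h]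
    exact A.bot_mem
  · exact (A.edges_sub _ (Or.inr hu)).2

theorem AnnDAG.lastN_eq {R : Type} (A : AnnDAG R) {r : R} {v : ANode}
    (hv : Relation.ReflTransGen (fun a b => (a, r, b) ∈ A.EW) ANode.bot v)
    (hend : ∀ w, (v, r, w) ∉ A.EW) : lastN A.EW r = v := by
  have huniq : ∃! v, Relation.ReflTransGen (fun a b => (a, r, b) ∈ A.EW) ANode.bot v ∧
      ∀ w, (v, r, w) ∉ A.EW := by
    refine ⟨v, ⟨hv, hend⟩, ?_⟩
    rintro u ⟨hu, hu'⟩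
    have hru : Relator.RightUnique (fun a b => (a, r, b) ∈ A.EW) :=
      fun a b c hb hc => A.w_out_unique a r b c hb hc
    rcases Relation.ReflTransGen.total_of_right_unique hru hu hv with h | h
    · rcases Relation.ReflTransGen.cases_head h with h | ⟨w, hw, -⟩
      · exact h
      · exact absurd hw (hu' w)
    · rcases Relation.ReflTransGen.cases_head h with h | ⟨w, hw, -⟩
      · exact h.symm
      · exact absurd hw (hend w)
  have hlast : lastN A.EW r = huniq.exists.choose := by
    unfold lastN
    rw [dif_pos huniq]
  rw [hlast]
  exact huniq.unique huniq.exists.choose_spec ⟨hv, hend⟩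

/-- The node added by a forward transition from `A` with process identifier `p`. -/
noncomputable def AnnDAG.fresh {R : Type} (A : AnnDAG R) (p : PID) : ANode :=
  ANode.node p (maxpSucc A.V p)

theorem AnnDAG.fresh_notMem {R : Type} (A : AnnDAG R) (p : PID) : A.fresh p ∉ A.V :=
  fun h => lt_irrefl _ ((A.node_mem_iff p _).mp h)

namespace Step

variable {R : Type} {A₁ A₂ A : AnnDAG R} {p q : PID} {Rd Wt Rd' Wt' : Set R}

theorem mem_V_iff (h : Step A₁ A p Rd Wt) (v : ANode) :
    v ∈ A₁.V ↔ v ∈ A.V ∧ v ≠ A₁.fresh p := by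
  have hf := A₁.fresh_notMem p
  rw [h.1]
  change _ ↔ (v ∈ A₁.V ∨ v = A₁.fresh p) ∧ _
  grind

theorem mem_ER_iff (h : Step A₁ A p Rd Wt) (e : AEdge R) :
    e ∈ A₁.ER ↔ e ∈ A.ER ∧ e.2.2 ≠ A₁.fresh p := by
  rw [h.2.1]
  constructor
  · intro he
    refine ⟨Or.inl he, fun h' => A₁.fresh_notMem p ?_⟩
    rw [← h']
    exact (A₁.edges_sub e (Or.inl he)).2
  · rintro ⟨he | ⟨r, -, rfl⟩, hne⟩
    · exact he
    · exact absurd rfl hne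

theorem mem_EW_iff (h : Step A₁ A p Rd Wt) (e : AEdge R) :
    e ∈ A₁.EW ↔ e ∈ A.EW ∧ e.2.2 ≠ A₁.fresh p := by
  rw [h.2.2]
  constructor
  · intro he
    refine ⟨Or.inl he, fun h' => A₁.fresh_notMem p ?_⟩
    rw [← h']
    exact (A₁.edges_sub e (Or.inr he)).2
  · rintro ⟨he | ⟨r, -, rfl⟩, hne⟩
    · exact he
    · exact absurd rfl hne

theorem fresh_no_out (h : Step A₁ A p Rd Wt) (r : R) (w : ANode) :
    (A₁.fresh p, r, w) ∉ A.ER ∪ A.EW := by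
  have hf := A₁.fresh_notMem p
  have hlast : ∀ s, A₁.fresh p ≠ lastN A₁.EW s := fun s hs => hf (hs ▸ A₁.lastN_mem s)
  rw [h.2.1, h.2.2]
  rintro ((he | ⟨s, -, hs⟩) | (he | ⟨s, -, hs⟩))
  · exact hf (A₁.edges_sub _ (Or.inl he)).1
  · exact hlast s (congrArg Prod.fst hs)
  · exact hf (A₁.edges_sub _ (Or.inr he)).1
  · exact hlast s (congrArg Prod.fst hs)

theorem fresh_eq_of_pid_eq (h₁ : Step A₁ A p Rd Wt) (h₂ : Step A₂ A p Rd' Wt') :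
    A₁.fresh p = A₂.fresh p := by
  have key : ∀ {B : AnnDAG R} {S T : Set R}, Step B A p S T →
      maxpSucc A.V p = maxpSucc B.V p + 1 := by
    intro B S T h
    have hiff : ∀ n, n < maxpSucc A.V p ↔ n < maxpSucc B.V p + 1 := by
      intro n
      rw [← A.node_mem_iff, h.1]
      change ANode.node p n ∈ B.V ∨ ANode.node p n = ANode.node p _ ↔ _
      rw [B.node_mem_iff]
      simp only [ANode.node.injEq, true_and]
      omega
    have h1 := hiff (maxpSucc B.V p)
    have h2 := hiff (maxpSucc B.V p + 1)
    omega
  have h1 := key h₁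
  have h2 := key h₂
  unfold AnnDAG.fresh
  congr 1
  omega

theorem source_unique (h₁ : Step A₁ A p Rd Wt) (h₂ : Step A₂ A q Rd' Wt')
    (hf : A₁.fresh p = A₂.fresh q) : A₁ = A₂ := by
  apply AnnDAG.ext_of_components <;> ext e
  · rw [h₁.mem_V_iff, h₂.mem_V_iff, hf]
  · rw [h₁.mem_ER_iff, h₂.mem_ER_iff, hf]
  · rw [h₁.mem_EW_iff, h₂.mem_EW_iff, hf]

end Step

/-- The componentwise intersection of two annotation DAGs whose write edges lie in a common
annotation DAG. -/
def AnnDAG.meet {R : Type} (A₁ A₂ A : AnnDAG R) (h₁ : A₁.EW ⊆ A.EW) (h₂ : A₂.EW ⊆ A.EW) :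
    AnnDAG R where
  V := A₁.V ∩ A₂.V
  ER := A₁.ER ∩ A₂.ER
  EW := A₁.EW ∩ A₂.EW
  finV := A₁.finV.inter_of_left _
  bot_mem := ⟨A₁.bot_mem, A₂.bot_mem⟩
  down p n h n' hn := ⟨A₁.down p n h.1 n' hn, A₂.down p n h.2 n' hn⟩
  edges_sub e he := by
    have he₁ := A₁.edges_sub e (he.imp And.left And.left)
    have he₂ := A₂.edges_sub e (he.imp And.right And.right)
    exact ⟨⟨he₁.1, he₂.1⟩, ⟨he₁.2, he₂.2⟩⟩
  in_unique v' v'' r v h h' :=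
    A₁.in_unique v' v'' r v (h.imp And.left And.left) (h'.imp And.left And.left)
  disj := by
    ext e
    have := Set.ext_iff.mp A₁.disj e
    simp only [Set.mem_inter_iff, Set.mem_empty_iff_false, iff_false] at this ⊢
    tauto
  acyclic v h :=
    A₁.acyclic v (Relation.TransGen.mono (fun _ _ ⟨r, hr⟩ => ⟨r, hr.imp And.left And.left⟩) _ _ h)
  w_pred v' r v h hb := by
    obtain ⟨u, hu⟩ := A₁.w_pred v' r v h.1 hb
    obtain ⟨w, hw⟩ := A₂.w_pred v' r v h.2 hb
    have huw := A.in_unique u w r v' (Or.inr (h₁ hu)) (Or.inr (h₂ hw))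
    exact ⟨u, hu, huw ▸ hw⟩
  w_out_unique v r v' v'' h h' := A₁.w_out_unique v r v' v'' h.1 h'.1

namespace Step

variable {R : Type} {A₁ A₂ A C : AnnDAG R} {p q : PID} {Rd Wt Rd' Wt' : Set R}

/-- A transition reading or writing `r` does not see the write to `r` of another last
transition. -/
theorem lastN_inter (h₁ : Step A₁ A p Rd Wt) (h₂ : Step A₂ A q Rd' Wt')
    (hne : A₁.fresh p ≠ A₂.fresh q) {r : R} (hr : r ∈ Rd ∪ Wt) :
    lastN (A₁.EW ∩ A₂.EW) r = lastN A₁.EW r := by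
  by_cases hw : r ∈ Wt'
  · exfalso
    have hmem : ∀ y, Relation.ReflTransGen (fun a b => (a, r, b) ∈ A.EW) ANode.bot y →
        y ≠ A₁.fresh p →
        Relation.ReflTransGen (fun a b => (a, r, b) ∈ A₁.EW) ANode.bot y := by
      intro y hy
      induction hy with
      | refl => exact fun _ => .refl
      | tail _ hbc ih =>
        intro hc
        refine .tail (ih ?_) ((h₁.mem_EW_iff _).mpr ⟨hbc, hc⟩)
        rintro rfl
        exact h₁.fresh_no_out _ _ (Or.inr hbc)
    have hedge : (lastN A₂.EW r, r, A₂.fresh q) ∈ A.EW := by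
      rw [h₂.2.2]
      exact Or.inr ⟨r, hw, rfl⟩
    have hreach : Relation.ReflTransGen (fun a b => (a, r, b) ∈ A.EW) ANode.bot
        (A₂.fresh q) :=
      .tail (Relation.ReflTransGen.mono (fun _ _ he => ((h₂.mem_EW_iff _).mp he).1) _ _
        (reflTransGen_lastN A₂.EW r)) hedge
    have hlast : lastN A₁.EW r = A₂.fresh q :=
      A₁.lastN_eq (hmem _ hreach hne.symm)
        fun w hw' => h₂.fresh_no_out r w (Or.inr ((h₁.mem_EW_iff _).mp hw').1)
    apply h₂.fresh_no_out r (A₁.fresh p)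
    rw [← hlast, h₁.2.1, h₁.2.2]
    by_cases hrw : r ∈ Wt
    · exact Or.inr (Or.inr ⟨r, hrw, rfl⟩)
    · exact Or.inl (Or.inr ⟨r, ⟨hr.resolve_right hrw, hrw⟩, rfl⟩)
  · apply lastN_congr
    intro x y
    refine ⟨And.left, fun h => ⟨h, ?_⟩⟩
    have hA := ((h₁.mem_EW_iff _).mp h).1
    rw [h₂.2.2] at hA
    rcases hA with hA | ⟨s, hs, he⟩
    · exact hA
    · simp only [Prod.mk.injEq] at he
      exact absurd (he.2.1 ▸ hs) hw

theorem of_inter (h₁ : Step A₁ A p Rd Wt) (h₂ : Step A₂ A q Rd' Wt')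
    (hne : A₁.fresh p ≠ A₂.fresh q) (hV : C.V = A₁.V ∩ A₂.V) (hR : C.ER = A₁.ER ∩ A₂.ER)
    (hW : C.EW = A₁.EW ∩ A₂.EW) : Step C A₂ p Rd Wt := by
  have hpq : p ≠ q := by
    rintro rfl
    exact hne (h₁.fresh_eq_of_pid_eq h₂)
  have hmax : maxpSucc C.V p = maxpSucc A₁.V p := by
    have hset : ∀ n, ANode.node p n ∈ C.V ↔ ANode.node p n ∈ A₁.V := by
      intro n
      rw [hV]
      refine ⟨And.left, fun h => ⟨h, (h₂.mem_V_iff _).mpr ⟨((h₁.mem_V_iff _).mp h).1, ?_⟩⟩⟩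
      intro he
      exact hpq (ANode.node.inj he).1
    unfold maxpSucc
    simp only [hset]
  have hlast : ∀ r ∈ Rd ∪ Wt, lastN C.EW r = lastN A₁.EW r := fun r hr => by
    rw [hW]
    exact h₁.lastN_inter h₂ hne hr
  refine ⟨?_, ?_, ?_⟩
  · ext v
    rw [h₂.mem_V_iff, h₁.1, hmax, hV]
    change (v ∈ A₁.V ∨ v = A₁.fresh p) ∧ _ ↔ (v ∈ A₁.V ∧ v ∈ A₂.V) ∨ v = A₁.fresh p
    have hv₁ := h₁.mem_V_iff v
    have hv₂ := h₂.mem_V_iff v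
    grind
  · ext e
    rw [h₂.mem_ER_iff, h₁.2.1, hmax, hR]
    constructor
    · rintro ⟨he | ⟨r, hr, rfl⟩, hf⟩
      · exact Or.inl ⟨he, (h₂.mem_ER_iff _).mpr ⟨((h₁.mem_ER_iff _).mp he).1, hf⟩⟩
      · exact Or.inr ⟨r, hr, by rw [hlast r (Or.inl hr.1)]⟩
    · rintro (⟨he, he₂⟩ | ⟨r, hr, rfl⟩)
      · exact ⟨Or.inl he, ((h₂.mem_ER_iff _).mp he₂).2⟩
      · exact ⟨Or.inr ⟨r, hr, by rw [hlast r (Or.inl hr.1)]⟩, hne⟩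
  · ext e
    rw [h₂.mem_EW_iff, h₁.2.2, hmax]
    constructor
    · rintro ⟨he | ⟨r, hr, rfl⟩, hf⟩
      · refine Or.inl ?_
        rw [hW]
        exact ⟨he, (h₂.mem_EW_iff _).mpr ⟨((h₁.mem_EW_iff _).mp he).1, hf⟩⟩
      · exact Or.inr ⟨r, hr, by rw [hlast r (Or.inr hr)]⟩
    · rintro (he | ⟨r, hr, rfl⟩)
      · rw [hW] at he
        exact ⟨Or.inl he.1, ((h₂.mem_EW_iff _).mp he.2).2⟩
      · exact ⟨Or.inr ⟨r, hr, by rw [hlast r (Or.inr hr)]⟩, hne⟩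

/-- Two forward transitions into the same annotation DAG that add different nodes complete to a
square. -/
theorem exists_common_source (h₁ : Step A₁ A p Rd Wt) (h₂ : Step A₂ A q Rd' Wt')
    (hne : A₁.fresh p ≠ A₂.fresh q) :
    ∃ C : AnnDAG R, Step C A₂ p Rd Wt ∧ Step C A₁ q Rd' Wt' :=
  ⟨A₁.meet A₂ A (fun e he => ((h₁.mem_EW_iff e).mp he).1)
      (fun e he => ((h₂.mem_EW_iff e).mp he).1),
    h₁.of_inter h₂ hne rfl rfl rfl,
    h₂.of_inter h₁ hne.symm (Set.inter_comm _ _) (Set.inter_comm _ _) (Set.inter_comm _ _)⟩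

end Step

theorem not_step_Ainit {R : Type} {A : AnnDAG R} {p : PID} {Rd Wt : Set R} :
    ¬ Step A (Ainit R) p Rd Wt := by
  intro h
  have hmem : ANode.node p (maxpSucc A.V p) ∈ (Ainit R).V := by
    rw [h.1]
    exact Or.inr rfl
  exact ANode.noConfusion (Set.mem_singleton_iff.mp hmem)

theorem reachable_of_stepIn {R : Type} {O : Set (Label R)} {A A' : AnnDAG R}
    (hA : Relation.ReflTransGen (StepIn O) (Ainit R) A) (h : StepIn O A' A) :
    Relation.ReflTransGen (StepIn O) (Ainit R) A' := by
  induction hA generalizing A' with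
  | refl =>
    obtain ⟨l, -, hl⟩ := h
    exact absurd hl not_step_Ainit
  | @tail B _ hB hstep ih =>
    obtain ⟨l, hlO, hl⟩ := h
    obtain ⟨m, hmO, hm⟩ := hstep
    by_cases hf : A'.fresh l.1 = B.fresh m.1
    · rw [hl.source_unique hm hf]
      exact hB
    · obtain ⟨C, hCB, hCA'⟩ := hl.exists_common_source hm hf
      exact (ih ⟨l, hlO, hCB⟩).tail ⟨m, hmO, hCA'⟩

/-- the set of annotation DAGs reachable from `Ainit` by `O`-labeled
forward transitions is closed under `O`-labeled combined transitions in both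
directions. -/
theorem stmt12 {R : Type} (O : Set (Label R)) (A A' : AnnDAG R)
    (hA : Relation.ReflTransGen (StepIn O) (Ainit R) A)
    (h : ∃ l ∈ O, Step A A' l.1 l.2.1 l.2.2 ∨ Step A' A l.1 l.2.1 l.2.2) :
    Relation.ReflTransGen (StepIn O) (Ainit R) A' := by
  obtain ⟨l, hl, h | h⟩ := h
  · exact hA.tail ⟨l, hl, h⟩
  · exact reachable_of_stepIn hA ⟨l, hl, h⟩

end CRIL
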